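/- arXiv:2502.16193 — 2 statements merged into one kernel-verified Lean document; each statement's English description precedes it below -/
import Mathlib

section
/- Let G be a connected graph with positive edge lengths, let H be a subgraph of G, and let U be a vertex set with ∂H ⊆ U ⊆ V(H). Then H is an isometric subgraph of G if and only if Σ_{x,y∈U} d_H(x,y) = Σ_{x,y∈U} d_G(x,y), where the sums range over all ordered pairs of vertices of U. -/
open scoped ENNReal

namespace PaperIso

variable {V : Type*}

/-- The length of a walk: sum of the lengths of its edges (with multiplicity). -/
noncomputable def wLen {G : SimpleGraph V} (ℓ : Sym2 V → ℝ≥0∞) {x y : V} (w : G.Walk x y) :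
    ℝ≥0∞ :=
  (w.edges.map ℓ).sum

/-- The weighted distance in `G`: the infimum of the lengths of walks from `x` to `y`;
it equals `⊤` when there is no walk from `x` to `y`. -/
noncomputable def eDist (G : SimpleGraph V) (ℓ : Sym2 V → ℝ≥0∞) (x y : V) : ℝ≥0∞ :=
  ⨅ w : G.Walk x y, wLen ℓ w

/-- The edge lengths are positive reals (positive and finite) on every edge of `G`. -/
def PosLengths (G : SimpleGraph V) (ℓ : Sym2 V → ℝ≥0∞) : Prop :=
  ∀ e ∈ G.edgeSet, 0 < ℓ e ∧ ℓ e < ⊤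

/-- The boundary `∂H`: vertices of `H` incident to some edge of `E(G) \ E(H)`. -/
def boundary (G : SimpleGraph V) (H : G.Subgraph) : Set V :=
  {v | v ∈ H.verts ∧ ∃ u, G.Adj v u ∧ ¬ H.Adj v u}

/-- `H` is an isometric subgraph of `G` (with respect to lengths `ℓ`). -/
def IsIsometric (G : SimpleGraph V) (ℓ : Sym2 V → ℝ≥0∞) (H : G.Subgraph) : Prop :=
  ∀ x ∈ H.verts, ∀ y ∈ H.verts, eDist H.spanningCoe ℓ x y = eDist G ℓ x y

/-- `p` is a minimum-length (shortest) path with respect to lengths `ℓ`. -/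
def IsShortestPath (G : SimpleGraph V) (ℓ : Sym2 V → ℝ≥0∞) {x y : V} (p : G.Walk x y) : Prop :=
  p.IsPath ∧ ∀ q : G.Walk x y, q.IsPath → wLen ℓ p ≤ wLen ℓ q

/-- `H` is a (geodesically) convex subgraph of `G`: every minimum-length path of `G`
between vertices of `H` is contained in `H`. -/
def IsConvex (G : SimpleGraph V) (ℓ : Sym2 V → ℝ≥0∞) (H : G.Subgraph) : Prop :=
  ∀ x ∈ H.verts, ∀ y ∈ H.verts, ∀ p : G.Walk x y, IsShortestPath G ℓ p → p.toSubgraph ≤ H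

/-- `ε(G,ℓ) = (1/n) · min{ℓ(π) − ℓ(π') : π, π' paths of G with ℓ(π) > ℓ(π')}`. -/
noncomputable def eps [Fintype V] (G : SimpleGraph V) (ℓ : Sym2 V → ℝ≥0∞) : ℝ≥0∞ :=
  (⨅ (x : V) (y : V) (x' : V) (y' : V) (p : G.Path x y) (q : G.Path x' y')
      (_ : wLen ℓ (q : G.Walk x' y') < wLen ℓ (p : G.Walk x y)),
      (wLen ℓ (p : G.Walk x y) - wLen ℓ (q : G.Walk x' y'))) / (Fintype.card V : ℝ≥0∞)

open scoped Classical in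
/-- The perturbed lengths `ℓ̂`: edges not in `H` are shortened by `δ`. -/
noncomputable def pert {G : SimpleGraph V} (H : G.Subgraph) (ℓ : Sym2 V → ℝ≥0∞) (δ : ℝ≥0∞) :
    Sym2 V → ℝ≥0∞ :=
  fun e => if e ∈ H.edgeSet then ℓ e else ℓ e - δ

theorem eDist_le_wLen {G : SimpleGraph V} (ℓ : Sym2 V → ℝ≥0∞) {x y : V} (w : G.Walk x y) :
    eDist G ℓ x y ≤ wLen ℓ w := iInf_le _ w

theorem wLen_reverse {G : SimpleGraph V} (ℓ : Sym2 V → ℝ≥0∞) {x y : V} (w : G.Walk x y) :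
    wLen ℓ w.reverse = wLen ℓ w := by
  simp [wLen, List.sum_reverse]

theorem eDist_comm (G : SimpleGraph V) (ℓ : Sym2 V → ℝ≥0∞) (x y : V) :
    eDist G ℓ x y = eDist G ℓ y x := by
  apply le_antisymm
  · refine le_iInf fun w => ?_
    rw [← wLen_reverse]
    exact eDist_le_wLen ℓ _
  · refine le_iInf fun w => ?_
    rw [← wLen_reverse]
    exact eDist_le_wLen ℓ _

theorem eDist_cons (G : SimpleGraph V) (ℓ : Sym2 V → ℝ≥0∞) {x z : V} (y : V) (h : G.Adj x z) :
    eDist G ℓ x y ≤ ℓ s(x, z) + eDist G ℓ z y := by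
  unfold eDist
  rw [ENNReal.add_iInf]
  refine le_iInf fun w => ?_
  refine (iInf_le _ (SimpleGraph.Walk.cons h w)).trans ?_
  simp [wLen]

theorem eDist_mono (G : SimpleGraph V) (ℓ : Sym2 V → ℝ≥0∞) (H : G.Subgraph) (x y : V) :
    eDist G ℓ x y ≤ eDist H.spanningCoe ℓ x y := by
  refine le_iInf fun w => ?_
  refine (eDist_le_wLen ℓ (w.mapLe H.spanningCoe_le)).trans ?_
  simp [wLen]

theorem eDist_ne_top (G : SimpleGraph V) (ℓ : Sym2 V → ℝ≥0∞)
    (hG : G.Connected) (hℓ : PosLengths G ℓ) (x y : V) : eDist G ℓ x y ≠ ⊤ := by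
  obtain ⟨w⟩ := hG.preconnected x y
  refine ne_top_of_le_ne_top ?_ (eDist_le_wLen ℓ w)
  induction w with
  | nil => simp [wLen]
  | cons h w ih =>
    simp only [wLen, SimpleGraph.Walk.edges_cons, List.map_cons, List.sum_cons]
    exact ENNReal.add_ne_top.2 ⟨(hℓ _ h).2.ne, ih⟩

/-- If the target `y` is well-behaved with respect to all of `U`, then it is with respect to `H`. -/
theorem extend_aux (G : SimpleGraph V) (ℓ : Sym2 V → ℝ≥0∞) (H : G.Subgraph) (U : Set V)
    (hU1 : boundary G H ⊆ U) {x y : V} (w : G.Walk x y) (hx : x ∈ H.verts)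
    (hy : ∀ u ∈ U, eDist H.spanningCoe ℓ u y = eDist G ℓ u y) :
    eDist H.spanningCoe ℓ x y ≤ wLen ℓ w := by
  induction w with
  | nil => exact (eDist_le_wLen ℓ SimpleGraph.Walk.nil).trans (by simp [wLen])
  | @cons x z y h w ih =>
    by_cases hxz : H.Adj x z
    · have h1 := ih hxz.snd_mem hy
      refine (eDist_cons H.spanningCoe ℓ y (z := z) (by simpa using hxz)).trans ?_
      simp only [wLen, SimpleGraph.Walk.edges_cons, List.map_cons, List.sum_cons]
      exact add_le_add le_rfl h1
    · rw [hy x (hU1 ⟨hx, z, h, hxz⟩)]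
      exact eDist_le_wLen ℓ _

theorem isometric_iff_sum_boundary [Fintype V] (G : SimpleGraph V) (ℓ : Sym2 V → ℝ≥0∞)
    (hG : G.Connected) (hℓ : PosLengths G ℓ) (H : G.Subgraph) (U : Set V)
    (hU1 : boundary G H ⊆ U) (hU2 : U ⊆ H.verts) :
    IsIsometric G ℓ H ↔
      ∑' (x : U) (y : U), eDist H.spanningCoe ℓ x.1 y.1
        = ∑' (x : U) (y : U), eDist G ℓ x.1 y.1 := by
  constructor
  · intro h
    refine tsum_congr fun x => tsum_congr fun y => h _ (hU2 x.2) _ (hU2 y.2)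
  · intro h
    classical
    have hfin : ∀ x : U, ∑' y : U, eDist G ℓ x.1 y.1 ≠ ⊤ := by
      intro x
      rw [tsum_fintype]
      exact ENNReal.sum_ne_top.2 fun y _ => eDist_ne_top G ℓ hG hℓ _ _
    have hfin2 : ∑' (x : U) (y : U), eDist G ℓ x.1 y.1 ≠ ⊤ := by
      rw [tsum_fintype]
      exact ENNReal.sum_ne_top.2 fun x _ => hfin x
    have key : ∀ x ∈ U, ∀ y ∈ U, eDist H.spanningCoe ℓ x y = eDist G ℓ x y := by
      intro x hx y hy
      by_contra hne
      have hlt := lt_of_le_of_ne (eDist_mono G ℓ H x y) (Ne.symm hne)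
      have h1 : ∑' b : U, eDist G ℓ x b.1 < ∑' b : U, eDist H.spanningCoe ℓ x b.1 :=
        ENNReal.tsum_lt_tsum (i := (⟨y, hy⟩ : U)) (hfin ⟨x, hx⟩)
          (fun b => eDist_mono G ℓ H x b.1) hlt
      have h2 : ∑' (a : U) (b : U), eDist G ℓ a.1 b.1
          < ∑' (a : U) (b : U), eDist H.spanningCoe ℓ a.1 b.1 :=
        ENNReal.tsum_lt_tsum (i := (⟨x, hx⟩ : U)) hfin2
          (fun a => ENNReal.tsum_le_tsum fun b => eDist_mono G ℓ H a.1 b.1) h1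
      exact h2.ne h.symm
    have ext : ∀ y, (∀ u ∈ U, eDist H.spanningCoe ℓ u y = eDist G ℓ u y) →
        ∀ x ∈ H.verts, eDist H.spanningCoe ℓ x y = eDist G ℓ x y := fun y hy x hx =>
      le_antisymm (le_iInf fun w => extend_aux G ℓ H U hU1 w hx hy) (eDist_mono G ℓ H x y)
    intro x hx y hy
    refine ext y (fun u hu => ?_) x hx
    rw [eDist_comm, eDist_comm G]
    exact ext u (fun v hv => key v hv u hu) y hy

end PaperIso
end

section
/- Let G be a connected graph with positive edge lengths ℓ, let H be a subgraph of G, let 0 < δ ≤ ε(G,ℓ), and let d̂_G be the corresponding perturbed distance. Then H is a convex subgraph of G if and only if Σ_{x,y∈V(H)} d̂_G(x,y) = Σ_{x,y∈V(H)} d_H(x,y), where the sums range over all ordered pairs of vertices of H. -/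
open scoped ENNReal

namespace PaperIso

variable {V : Type*}

theorem wLen_eq_of_mem {G : SimpleGraph V} {ℓ ℓ' : Sym2 V → ℝ≥0∞} {x y : V} (w : G.Walk x y)
    (h : ∀ e ∈ w.edges, ℓ e = ℓ' e) : wLen ℓ w = wLen ℓ' w := by
  unfold wLen
  rw [List.map_congr_left h]

theorem wLen_mono {G : SimpleGraph V} {ℓ ℓ' : Sym2 V → ℝ≥0∞} {x y : V} (w : G.Walk x y)
    (h : ∀ e ∈ w.edges, ℓ e ≤ ℓ' e) : wLen ℓ w ≤ wLen ℓ' w :=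
  List.sum_le_sum h

theorem wLen_ne_top {G : SimpleGraph V} {ℓ : Sym2 V → ℝ≥0∞} (hℓ : PosLengths G ℓ) {x y : V}
    (w : G.Walk x y) : wLen ℓ w ≠ ⊤ := by
  induction w with
  | nil => simp [wLen]
  | cons h p ih =>
    simp only [wLen, SimpleGraph.Walk.edges_cons, List.map_cons, List.sum_cons] at ih ⊢
    exact ENNReal.add_ne_top.2 ⟨(hℓ _ ((SimpleGraph.mem_edgeSet G).2 h)).2.ne, ih⟩

theorem exists_path_le {G : SimpleGraph V} (ℓ : Sym2 V → ℝ≥0∞) {x y : V} (w : G.Walk x y) :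
    ∃ p : G.Walk x y, p.IsPath ∧ wLen ℓ p ≤ wLen ℓ w := by
  classical
  refine ⟨w.bypass, w.bypass_isPath, ?_⟩
  obtain ⟨l, hl, hsub⟩ := (w.edges_bypass_sublist_edges).exists_perm_append
    |>.imp fun l hl => And.intro hl trivial
  unfold wLen
  rw [(hl.map ℓ).sum_eq]
  simp

theorem pert_le {G : SimpleGraph V} (H : G.Subgraph) (ℓ : Sym2 V → ℝ≥0∞) (δ : ℝ≥0∞) (e : Sym2 V) :
    pert H ℓ δ e ≤ ℓ e := by
  unfold pert
  split_ifs
  · exact le_rfl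
  · exact tsub_le_self

theorem wLen_le_pert {G : SimpleGraph V} (H : G.Subgraph) (ℓ : Sym2 V → ℝ≥0∞) (δ : ℝ≥0∞) {x y : V}
    (w : G.Walk x y) : wLen ℓ w ≤ wLen (pert H ℓ δ) w + δ * w.length := by
  induction w with
  | nil => simp [wLen]
  | cons h p ih =>
    simp only [wLen, SimpleGraph.Walk.edges_cons, List.map_cons, List.sum_cons,
      SimpleGraph.Walk.length_cons] at ih ⊢
    have h1 : ∀ e, ℓ e ≤ pert H ℓ δ e + δ := by
      intro e
      unfold pert
      split_ifs
      · exact le_self_add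
      · exact le_tsub_add
    refine (add_le_add (h1 _) ih).trans (le_of_eq ?_)
    push_cast
    ring

theorem wLen_pert_lt {G : SimpleGraph V} (H : G.Subgraph) {ℓ : Sym2 V → ℝ≥0∞}
    (hℓ : PosLengths G ℓ) {δ : ℝ≥0∞} (hδ : 0 < δ) {x y : V}
    (w : G.Walk x y) (e : Sym2 V) (he : e ∈ w.edges) (heH : e ∉ H.edgeSet) :
    wLen (pert H ℓ δ) w < wLen ℓ w := by
  induction w with
  | nil => simp at he
  | cons h p ih =>
    have hm : wLen (pert H ℓ δ) p ≤ wLen ℓ p := wLen_mono p fun e _ => pert_le H ℓ δ e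
    have ht := wLen_ne_top hℓ p
    simp only [SimpleGraph.Walk.edges_cons, List.mem_cons] at he
    simp only [wLen, SimpleGraph.Walk.edges_cons, List.map_cons, List.sum_cons] at ih ⊢ hm ht
    have hp := hℓ _ ((SimpleGraph.mem_edgeSet G).2 h)
    rcases he with rfl | he
    · refine ENNReal.add_lt_add_of_lt_of_le (ne_top_of_le_ne_top ht hm) ?_ hm
      unfold pert
      rw [if_neg heH]
      exact ENNReal.sub_lt_self hp.2.ne hp.1.ne' hδ.ne'
    · exact ENNReal.add_lt_add_of_le_of_lt (ne_top_of_le_ne_top hp.2.ne (pert_le H ℓ δ _))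
        (pert_le H ℓ δ _) (ih he)

theorem exists_shortest [Finite V] {G : SimpleGraph V} (hG : G.Connected) (ℓ : Sym2 V → ℝ≥0∞)
    (x y : V) : ∃ p : G.Walk x y, IsShortestPath G ℓ p := by
  classical
  have := Fintype.ofFinite V
  have : Finite (G.Path x y) := inferInstance
  obtain ⟨w⟩ := hG.preconnected x y
  have : Nonempty (G.Path x y) := ⟨w.toPath⟩
  obtain ⟨p, hp⟩ := Finite.exists_min (fun p : G.Path x y => wLen ℓ (p : G.Walk x y))
  exact ⟨p.1, p.2, fun q hq => hp ⟨q, hq⟩⟩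

theorem shortest_le {G : SimpleGraph V} {ℓ : Sym2 V → ℝ≥0∞} {x y : V} {p : G.Walk x y}
    (hp : IsShortestPath G ℓ p) (w : G.Walk x y) : wLen ℓ p ≤ wLen ℓ w := by
  obtain ⟨q, hq, hle⟩ := exists_path_le ℓ w
  exact (hp.2 q hq).trans hle

theorem eDist_pert_le {G : SimpleGraph V} (H : G.Subgraph) (ℓ : Sym2 V → ℝ≥0∞) (δ : ℝ≥0∞)
    (x y : V) : eDist G (pert H ℓ δ) x y ≤ eDist H.spanningCoe ℓ x y := by
  refine le_iInf fun w => ?_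
  refine (iInf_le _ (w.mapLe H.spanningCoe_le)).trans ?_
  unfold wLen
  rw [SimpleGraph.Walk.edges_mapLe_eq_edges]
  exact List.sum_le_sum fun e _ => pert_le H ℓ δ e

theorem eDist_le_spanningCoe {G : SimpleGraph V} (H : G.Subgraph) (ℓ : Sym2 V → ℝ≥0∞)
    (x y : V) : eDist G ℓ x y ≤ eDist H.spanningCoe ℓ x y := by
  refine le_iInf fun w => ?_
  refine (iInf_le _ (w.mapLe H.spanningCoe_le)).trans ?_
  unfold wLen
  rw [SimpleGraph.Walk.edges_mapLe_eq_edges]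

theorem toSubgraph_le_of_edges {G : SimpleGraph V} (H : G.Subgraph) {x y : V} (hx : x ∈ H.verts)
    (w : G.Walk x y) (h : ∀ e ∈ w.edges, e ∈ H.edgeSet) : w.toSubgraph ≤ H := by
  induction w with
  | nil => simpa using hx
  | cons hadj p ih =>
    have h0 := h _ (by rw [SimpleGraph.Walk.edges_cons]; exact List.mem_cons_self)
    have h0' : H.Adj _ _ := SimpleGraph.Subgraph.mem_edgeSet.1 h0
    rw [SimpleGraph.Walk.toSubgraph]
    refine sup_le (SimpleGraph.subgraphOfAdj_le_of_adj H h0') (ih h0'.snd_mem fun e he => h e ?_)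
    rw [SimpleGraph.Walk.edges_cons]
    exact List.mem_cons_of_mem _ he

theorem edges_of_toSubgraph_le {G : SimpleGraph V} {H : G.Subgraph} {x y : V}
    {w : G.Walk x y} (h : w.toSubgraph ≤ H) : ∀ e ∈ w.edges, e ∈ H.edgeSet := fun _ he =>
  SimpleGraph.Subgraph.edgeSet_mono h (w.mem_edges_toSubgraph.2 he)

theorem eps_bound [Fintype V] {G : SimpleGraph V} {ℓ : Sym2 V → ℝ≥0∞} {δ : ℝ≥0∞}
    (hδ : δ ≤ eps G ℓ) {x y : V} {p q : G.Walk x y} (hp : p.IsPath) (hq : q.IsPath)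
    (hlt : wLen ℓ p < wLen ℓ q) : δ * Fintype.card V ≤ wLen ℓ q - wLen ℓ p := by
  refine (ENNReal.mul_le_of_le_div hδ).trans ?_
  exact iInf_le_of_le x <| iInf_le_of_le y <| iInf_le_of_le x <| iInf_le_of_le y <|
    iInf_le_of_le ⟨q, hq⟩ <| iInf_le_of_le ⟨p, hp⟩ <| iInf_le_of_le hlt le_rfl

theorem tsum_tsum_eq_iff {ι : Type*} [Finite ι] (f g : ι → ι → ℝ≥0∞) (hf : ∀ i j, f i j ≠ ⊤)
    (hle : ∀ i j, f i j ≤ g i j) :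
    ∑' (i : ι) (j : ι), f i j = ∑' (i : ι) (j : ι), g i j ↔ ∀ i j, f i j = g i j := by
  have := Fintype.ofFinite ι
  constructor
  · intro h i j
    by_contra hne
    have hlt := lt_of_le_of_ne (hle i j) hne
    have hin : ∀ i, ∑' j, f i j ≠ ⊤ := fun i => by
      rw [tsum_fintype]; exact ENNReal.sum_ne_top.2 fun j _ => hf i j
    have hout : ∑' i, ∑' j, f i j ≠ ⊤ := by
      rw [tsum_fintype]; exact ENNReal.sum_ne_top.2 fun i _ => hin i
    exact (ENNReal.tsum_lt_tsum hout (fun i => ENNReal.tsum_le_tsum (hle i))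
      (ENNReal.tsum_lt_tsum (hin i) (hle i) hlt)).ne h
  · intro h
    simp only [h]

theorem convex_iff_pert_sum [Fintype V] (G : SimpleGraph V) (ℓ : Sym2 V → ℝ≥0∞)
    (hG : G.Connected) (hℓ : PosLengths G ℓ) (H : G.Subgraph)
    (δ : ℝ≥0∞) (hδ0 : 0 < δ) (hδ : δ ≤ eps G ℓ) :
    IsConvex G ℓ H ↔
      ∑' (x : H.verts) (y : H.verts), eDist G (pert H ℓ δ) x.1 y.1
        = ∑' (x : H.verts) (y : H.verts), eDist H.spanningCoe ℓ x.1 y.1 := by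
  have hsum := tsum_tsum_eq_iff (ι := H.verts)
    (fun x y => eDist G (pert H ℓ δ) x.1 y.1) (fun x y => eDist H.spanningCoe ℓ x.1 y.1)
    (fun x y => by
      obtain ⟨w⟩ := hG.preconnected x.1 y.1
      exact ne_top_of_le_ne_top (wLen_ne_top hℓ w)
        ((iInf_le _ w).trans (wLen_mono w fun e _ => pert_le H ℓ δ e)))
    (fun x y => eDist_pert_le H ℓ δ x.1 y.1)
  rw [hsum]
  constructor
  · rintro hc ⟨x, hx⟩ ⟨y, hy⟩
    refine le_antisymm (eDist_pert_le H ℓ δ x y) ?_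
    obtain ⟨p, hp⟩ := exists_shortest hG ℓ x y
    have hpH := edges_of_toSubgraph_le (hc x hx y hy p hp)
    have h1 : eDist H.spanningCoe ℓ x y ≤ wLen ℓ p := by
      refine (iInf_le _ (p.transfer H.spanningCoe fun e he => ?_)).trans ?_
      · rw [SimpleGraph.Subgraph.edgeSet_spanningCoe]
        exact hpH e he
      · unfold wLen
        rw [SimpleGraph.Walk.edges_transfer]
    refine h1.trans (le_iInf fun w => ?_)
    obtain ⟨q, hq, hle⟩ := exists_path_le (pert H ℓ δ) w
    refine le_trans ?_ hle
    rcases (hp.2 q hq).eq_or_lt with heq | hlt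
    · have hqs : IsShortestPath G ℓ q := ⟨hq, fun r hr => heq ▸ hp.2 r hr⟩
      have hqH := edges_of_toSubgraph_le (hc x hx y hy q hqs)
      rw [heq]
      refine (wLen_eq_of_mem q fun e he => ?_).le
      unfold pert
      rw [if_pos (hqH e he)]
    · have hb := eps_bound hδ hp.1 hq hlt
      have hfin : δ * Fintype.card V ≠ ⊤ :=
        ne_top_of_le_ne_top (wLen_ne_top hℓ q) (hb.trans tsub_le_self)
      refine (ENNReal.add_le_add_iff_right hfin).1 ?_
      calc wLen ℓ p + δ * Fintype.card V ≤ wLen ℓ p + (wLen ℓ q - wLen ℓ p) := by gcongr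
        _ = wLen ℓ q := add_tsub_cancel_of_le hlt.le
        _ ≤ wLen (pert H ℓ δ) q + δ * q.length := wLen_le_pert H ℓ δ q
        _ ≤ _ := by
          have := hq.length_lt.le
          gcongr
  · intro h x hx y hy p hp
    refine toSubgraph_le_of_edges H hx p fun e he => ?_
    by_contra heH
    refine (wLen_pert_lt H hℓ hδ0 p e he heH).not_ge ?_
    calc wLen ℓ p ≤ eDist G ℓ x y := le_iInf fun w => shortest_le hp w
      _ ≤ eDist H.spanningCoe ℓ x y := eDist_le_spanningCoe H ℓ x y
      _ = eDist G (pert H ℓ δ) x y := (h ⟨x, hx⟩ ⟨y, hy⟩).symm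
      _ ≤ _ := iInf_le _ p

end PaperIso
end
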